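/- Let s > −1, J ∈ ℕ, λ ≥ 1 and C₀ > 0. For j = 1, …, J let c_j ∈ C_c^∞(T³) and k_j ∈ ℝ³ with C₀^{−1} ≤ |k_j| ≤ C₀. Suppose the supports of at most J_* of the functions c_j have a nonempty common intersection (so the product of any J_*+1 of them is identically 0), and set f(x) := Σ_{j=1}^{J} c_j(x) e^{iλ k_j·x}. Then for any nonnegative integer m, ‖f‖_{B^s_{∞,∞}} ≤ C_* (λ^s 𝒞₀ + λ^{−m} 𝒞_{m+s₊}), where s₊ := max{s,0}, 𝒞_σ := max_{j≤J} ‖c_j‖_σ, and C_* depends only on s, m, J_* and C₀ (not on J). -/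

import Mathlib

noncomputable section

open MeasureTheory Filter Topology

/-- Points/vectors of `ℝ³`. -/
abbrev V3 : Type := Fin 3 → ℝ

/-- Standard basis vectors. -/
def e3 (i : Fin 3) : V3 := fun j => if j = i then 1 else 0

/-- Euclidean scalar product. -/
def dot3 (a b : V3) : ℝ := ∑ i, a i * b i

/-- Euclidean norm. -/
def norm3 (a : V3) : ℝ := Real.sqrt (dot3 a a)

/-- Cross product. -/
def cross3 (a b : V3) : V3 :=
  ![a 1 * b 2 - a 2 * b 1, a 2 * b 0 - a 0 * b 2, a 0 * b 1 - a 1 * b 0]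

/-- An integer vector, viewed in `ℝ³`. -/
def intVec (m : Fin 3 → ℤ) : V3 := fun i => (m i : ℝ)

/-- `ℤ³`-periodicity: a function on `ℝ³` represents a function on `T³ = (ℝ/ℤ)³`. -/
def Per {F : Type*} (f : V3 → F) : Prop := ∀ (x : V3) (m : Fin 3 → ℤ), f (x + intVec m) = f x

/-- A lift of a (degree one) map `T³ → T³`. -/
def TorusMap (Φ : V3 → V3) : Prop :=
  ∀ (x : V3) (m : Fin 3 → ℤ), Φ (x + intVec m) = Φ x + intVec m

/-- Fundamental domain of the torus. -/
def cube3 : Set V3 := Set.univ.pi fun _ => Set.Ico (0:ℝ) 1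

/-- Gradient of a scalar function. -/
def grad3 (f : V3 → ℝ) (x : V3) : V3 := fun i => fderiv ℝ f x (e3 i)

/-- Divergence of a vector field. -/
def div3 (v : V3 → V3) (x : V3) : ℝ := ∑ i, fderiv ℝ v x (e3 i) i

/-- Divergence of a matrix-valued field, `(Div S)_i = ∂_j S_{ij}`. -/
def divM (S : V3 → Fin 3 → Fin 3 → ℝ) (x : V3) : V3 := fun i => ∑ j, fderiv ℝ S x (e3 j) i j

/-- Sup (C⁰) norm. -/
def C0Norm {F : Type*} [NormedAddCommGroup F] (f : V3 → F) : ℝ := ⨆ x, ‖f x‖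

/-- Sup norm over a set. -/
def C0NormOn {F : Type*} [NormedAddCommGroup F] (s : Set V3) (f : V3 → F) : ℝ :=
  ⨆ x : s, ‖f (x : V3)‖

/-- `C^N` norm (sum of sup-norms of iterated derivatives). -/
def CN {F : Type*} [NormedAddCommGroup F] [NormedSpace ℝ F] (N : ℕ) (f : V3 → F) : ℝ :=
  ∑ k ∈ Finset.range (N+1), ⨆ x, ‖iteratedFDeriv ℝ k f x‖

open Classical in
/-- Hölder seminorm of exponent `τ`. -/
def hsemi {F : Type*} [NormedAddCommGroup F] (τ : ℝ) (f : V3 → F) : ℝ :=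
  ⨆ p : V3 × V3, if p.1 = p.2 then 0 else ‖f p.1 - f p.2‖ / norm3 (p.1 - p.2) ^ τ

/-- `C^s` Hölder norm for a real exponent `s ≥ 0`. -/
def CsNorm {F : Type*} [NormedAddCommGroup F] [NormedSpace ℝ F] (s : ℝ) (f : V3 → F) : ℝ :=
  CN ⌊s⌋₊ f + hsemi (s - ⌊s⌋₊) (fun x => iteratedFDeriv ℝ ⌊s⌋₊ f x)

/-- Hölder continuity with exponent `τ`. -/
def HolderCont {F : Type*} [NormedAddCommGroup F] (τ : ℝ) (f : V3 → F) : Prop :=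
  ∃ C : ℝ, ∀ x y : V3, ‖f x - f y‖ ≤ C * norm3 (x - y) ^ τ

/-! ### Fourier transform and Littlewood–Paley/Besov norms on ℝ³ -/

/-- Fourier transform on `ℝ³`. -/
def ftr (f : V3 → ℂ) : V3 → ℂ :=
  fun ξ => ∫ x : V3, Complex.exp (-(2 * Real.pi * Complex.I) * (dot3 x ξ : ℂ)) * f x

/-- Inverse Fourier transform on `ℝ³`. -/
def iftr (g : V3 → ℂ) : V3 → ℂ :=
  fun x => ∫ ξ : V3, Complex.exp ((2 * Real.pi * Complex.I) * (dot3 x ξ : ℂ)) * g ξ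

/-- The Fourier multiplier `m(D)` applied to `f`. -/
def fmult (m : V3 → ℝ) (f : V3 → ℂ) : V3 → ℂ :=
  iftr fun ξ => (m ξ : ℂ) * ftr f ξ

/-- A Littlewood–Paley pair `(χ, φ)`: smooth radial functions valued in `[0,1]` with
`supp χ ⊆ B(0,4/3)`, `supp φ ⊆ {3/4 < |ξ| < 8/3}`, and `χ(ξ) + Σ_{N≥0} φ(2^{-N}ξ) = 1`. -/
structure LPpair (χ φ : V3 → ℝ) : Prop where
  smooth : ContDiff ℝ (⊤ : ℕ∞) χ
  smooth' : ContDiff ℝ (⊤ : ℕ∞) φ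
  radial : ∀ ξ ξ' : V3, norm3 ξ = norm3 ξ' → χ ξ = χ ξ'
  radial' : ∀ ξ ξ' : V3, norm3 ξ = norm3 ξ' → φ ξ = φ ξ'
  range01 : ∀ ξ, 0 ≤ χ ξ ∧ χ ξ ≤ 1
  range01' : ∀ ξ, 0 ≤ φ ξ ∧ φ ξ ≤ 1
  suppLow : ∀ ξ : V3, ¬ norm3 ξ < 4/3 → χ ξ = 0
  suppAnn : ∀ ξ : V3, ¬ (3/4 < norm3 ξ ∧ norm3 ξ < 8/3) → φ ξ = 0
  partition : ∀ ξ : V3, χ ξ + ∑' N : ℕ, φ ((2:ℝ) ^ (-(N:ℤ)) • ξ) = 1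

/-- Low-frequency projector `P_< = χ(D)`. -/
def lowProj (χ : V3 → ℝ) (f : V3 → ℂ) : V3 → ℂ := fmult χ f

/-- Dyadic block `P_N = φ(2^{-N} D)`. -/
def dyadProj (φ : V3 → ℝ) (N : ℕ) (f : V3 → ℂ) : V3 → ℂ :=
  fmult (fun ξ => φ ((2:ℝ) ^ (-(N:ℤ)) • ξ)) f

/-- The Besov `B^s_{∞,∞}` norm associated with a Littlewood–Paley pair `(χ, φ)`:
`‖h‖ = ‖P_< h‖₀ + sup_{N ≥ 0} 2^{Ns} ‖P_N h‖₀`. -/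
def BesovNorm (χ φ : V3 → ℝ) (s : ℝ) (f : V3 → ℂ) : ℝ :=
  C0Norm (lowProj χ f) + ⨆ N : ℕ, (2:ℝ) ^ ((N:ℝ) * s) * C0Norm (dyadProj φ N f)

/-- Besov norm of a real-valued function. -/
def BesovNormR (χ φ : V3 → ℝ) (s : ℝ) (f : V3 → ℝ) : ℝ :=
  BesovNorm χ φ s (fun x => (f x : ℂ))

open scoped FourierTransform SchwartzMap RealInnerProductSpace

/-- The Euclidean scalar product as a continuous bilinear form. -/
def dotCLM : V3 →L[ℝ] V3 →L[ℝ] ℝ :=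
  LinearMap.toContinuousLinearMap
    ((LinearMap.toContinuousLinearMap : (V3 →ₗ[ℝ] ℝ) ≃ₗ[ℝ] V3 →L[ℝ] ℝ).toLinearMap ∘ₗ
      dotProductBilin ℝ ℝ)

lemma dotCLM_apply (a b : V3) : dotCLM a b = dot3 a b := rfl

lemma dot3_comm (a b : V3) : dot3 a b = dot3 b a := by
  simp [dot3, mul_comm]

lemma dot3_eq_inner (a b : V3) : dot3 a b = ⟪WithLp.toLp 2 a, WithLp.toLp 2 b⟫ := by
  simp [dot3, PiLp.inner_apply, mul_comm]

lemma norm3_eq_norm (a : V3) : norm3 a = ‖(WithLp.toLp 2 a : EuclideanSpace ℝ (Fin 3))‖ := by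
  rw [norm3, dot3_eq_inner, real_inner_self_eq_norm_sq, Real.sqrt_sq (norm_nonneg _)]

lemma norm3_nonneg (a : V3) : 0 ≤ norm3 a := Real.sqrt_nonneg _

lemma norm3_smul (r : ℝ) (a : V3) : norm3 (r • a) = |r| * norm3 a := by
  simp [norm3_eq_norm, norm_smul]

lemma norm3_le (a : V3) : norm3 a ≤ 2 * ‖a‖ := by
  rw [norm3]
  refine Real.sqrt_le_iff.2 ⟨by positivity, ?_⟩
  have h : ∀ i, a i * a i ≤ ‖a‖ * ‖a‖ := fun i => by
    have := norm_le_pi_norm a i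
    rw [← abs_mul_abs_self (a i)]
    exact mul_self_le_mul_self (abs_nonneg _) this
  have h0 := h 0
  have h1 := h 1
  have h2 := h 2
  simp only [dot3, Fin.sum_univ_three]
  nlinarith [mul_self_nonneg ‖a‖]

lemma norm_le_norm3 (a : V3) : ‖a‖ ≤ norm3 a := by
  refine (pi_norm_le_iff_of_nonneg (norm3_nonneg a)).2 fun i => ?_
  rw [norm3_eq_norm]
  exact PiLp.norm_apply_le (WithLp.toLp 2 a : EuclideanSpace ℝ (Fin 3)) i

lemma continuous_norm3 : Continuous norm3 := by
  unfold norm3 dot3; fun_prop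

lemma ftr_eq_vectorFourier (f : V3 → ℂ) :
    ftr f = VectorFourier.fourierIntegral Real.fourierChar volume dotCLM.toLinearMap₁₂ f := by
  ext ξ
  simp only [ftr, VectorFourier.fourierIntegral, Circle.smul_def, Real.fourierChar_apply,
    smul_eq_mul]
  congr with x
  congr 2
  change _ = ((2 * Real.pi * -dot3 x ξ : ℝ) : ℂ) * Complex.I
  push_cast
  ring

lemma iftr_eq_ftr_comp_neg (f : V3 → ℂ) : iftr f = ftr fun x => f (-x) := by
  ext x
  simp only [ftr, iftr]
  rw [← integral_neg_eq_self]
  congr with ξ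
  congr 2
  simp [dot3, mul_comm]

lemma ftr_eq_fourier (f : V3 → ℂ) (ξ : V3) :
    ftr f ξ = 𝓕 (fun y : EuclideanSpace ℝ (Fin 3) => f y.ofLp) (WithLp.toLp 2 ξ) := by
  rw [Real.fourier_eq', ← (PiLp.volume_preserving_toLp (Fin 3)).integral_comp
    (MeasurableEquiv.toLp 2 (Fin 3 → ℝ)).measurableEmbedding]
  simp only [ftr, smul_eq_mul]
  congr with x
  congr 2
  rw [dot3_eq_inner]
  push_cast
  ring

/-- The Fourier transform of a Schwartz function is Schwartz, and Fourier inversion holds. -/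
lemma exists_schwartz_ftr (g : 𝓢(V3, ℂ)) :
    ∃ G : 𝓢(V3, ℂ), ⇑G = ftr g ∧ ∀ ξ, ftr G ξ = g (-ξ) := by
  let e : EuclideanSpace ℝ (Fin 3) ≃L[ℝ] V3 := EuclideanSpace.equiv (Fin 3) ℝ
  let g' : 𝓢(EuclideanSpace ℝ (Fin 3), ℂ) := SchwartzMap.compCLMOfContinuousLinearEquiv ℝ e g
  have h1 : ⇑(SchwartzMap.compCLMOfContinuousLinearEquiv ℝ e.symm (𝓕 g')) = ftr g := by
    ext ξ
    rw [ftr_eq_fourier]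
    rfl
  refine ⟨SchwartzMap.compCLMOfContinuousLinearEquiv ℝ e.symm (𝓕 g'), h1, fun ξ => ?_⟩
  have h2 := congrFun (g'.continuous.fourierInv_fourier_eq g'.integrable
    (by rw [← SchwartzMap.fourier_coe]; exact (𝓕 g').integrable)) (WithLp.toLp 2 (-ξ))
  rw [Real.fourierInv_eq_fourier_neg, ← SchwartzMap.fourier_coe] at h2
  rw [ftr_eq_fourier]
  have h3 : -WithLp.toLp 2 (-ξ) = (WithLp.toLp 2 ξ : EuclideanSpace ℝ (Fin 3)) := by
    rw [← WithLp.toLp_neg, neg_neg]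
  rw [h3] at h2
  exact h2

lemma fmult_eq_ftr {m : V3 → ℝ} (f : V3 → ℂ) (x : V3) :
    fmult m f x = ∫ ξ, ftr f ξ * (Complex.exp ((2 * Real.pi * Complex.I) * (dot3 x ξ : ℂ)) * m ξ) := by
  simp only [fmult, iftr]
  congr with ξ
  ring

/-- A dilated Fourier multiplier is an average of translates. -/
lemma fmult_dilate_eq_integral {ψ : V3 → ℝ} (hψ : Integrable fun ξ => (ψ ξ : ℂ)) {f : V3 → ℂ}
    (hf : Integrable f) {R : ℝ} (hR : 0 < R) (x : V3) :
    fmult (fun ξ => ψ (R⁻¹ • ξ)) f x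
      = ∫ z, ftr (fun ξ => (ψ ξ : ℂ)) z * f (x + R⁻¹ • z) := by
  have hint : Integrable fun ξ : V3 =>
      Complex.exp ((2 * Real.pi * Complex.I) * (dot3 x ξ : ℂ)) * (ψ (R⁻¹ • ξ) : ℂ) := by
    refine (hψ.comp_smul (inv_ne_zero hR.ne')).bdd_mul (c := 1) ?_ (Eventually.of_forall fun ξ => ?_)
    · refine Continuous.aestronglyMeasurable ?_
      unfold dot3
      fun_prop
    · rw [Complex.norm_exp]
      simp
  have key := VectorFourier.integral_fourierIntegral_smul_eq_flip (μ := volume) (ν := volume)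
    (L := dotCLM.toLinearMap₁₂) Real.continuous_fourierChar
    dotCLM.continuous₂ hf hint
  have hflip : dotCLM.toLinearMap₁₂.flip = dotCLM.toLinearMap₁₂ := by
    refine LinearMap.ext₂ fun a b => ?_
    exact dot3_comm _ _
  rw [hflip, ← ftr_eq_vectorFourier, ← ftr_eq_vectorFourier] at key
  simp only [smul_eq_mul] at key
  rw [fmult_eq_ftr, key]
  have hd : ∀ z : V3, ftr (fun ξ : V3 =>
      Complex.exp ((2 * Real.pi * Complex.I) * (dot3 x ξ : ℂ)) * (ψ (R⁻¹ • ξ) : ℂ)) (x + R⁻¹ • z)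
      = (R ^ 3 : ℝ) • ftr (fun ξ => (ψ ξ : ℂ)) z := by
    intro z
    have := Measure.integral_comp_inv_smul_of_nonneg (volume : Measure V3) (fun ξ : V3 =>
      Complex.exp (-(2 * Real.pi * Complex.I) * (dot3 ξ z : ℂ)) * (ψ ξ : ℂ)) hR.le
    rw [Module.finrank_fin_fun] at this
    simp only [ftr]
    rw [← this]
    congr with ξ
    rw [← mul_assoc, ← Complex.exp_add]
    congr 2
    simp only [dot3, Fin.sum_univ_three, Pi.add_apply, Pi.smul_apply, smul_eq_mul]
    push_cast
    ring
  have hcv := Measure.integral_comp_inv_smul_of_nonneg (volume : Measure V3) (fun y : V3 =>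
      f (x + y) * ftr (fun ξ : V3 =>
      Complex.exp ((2 * Real.pi * Complex.I) * (dot3 x ξ : ℂ)) * (ψ (R⁻¹ • ξ) : ℂ)) (x + y)) hR.le
  rw [Module.finrank_fin_fun, integral_add_left_eq_self (fun y : V3 =>
      f y * ftr (fun ξ : V3 =>
      Complex.exp ((2 * Real.pi * Complex.I) * (dot3 x ξ : ℂ)) * (ψ (R⁻¹ • ξ) : ℂ)) y)] at hcv
  simp only [hd] at hcv
  have hR3 : (R ^ 3 : ℝ) ≠ 0 := by positivity
  apply smul_right_injective ℂ hR3
  simp only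
  rw [← hcv, ← integral_smul]
  congr with z
  simp only [Complex.real_smul]
  ring

/-- Nested multipliers collapse when the inner symbol is `1` on the support of the outer one. -/
lemma fmult_fmult_eq {p q : V3 → ℝ} (hq : ContDiff ℝ (⊤ : ℕ∞) q) (hqc : HasCompactSupport q)
    (hpq : ∀ ξ, p ξ ≠ 0 → q ξ = 1) (f : 𝓢(V3, ℂ)) :
    fmult p (fmult q f) = fmult p f ∧ Integrable (fmult q f) := by
  obtain ⟨F, hF, -⟩ := exists_schwartz_ftr f
  have hqn : ContDiff ℝ (⊤ : ℕ∞) fun ξ => q (-ξ) := hq.comp contDiff_neg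
  have hqcn : HasCompactSupport fun ξ => q (-ξ) := hqc.comp_homeomorph (Homeomorph.neg V3)
  have hH2 : ContDiff ℝ (⊤ : ℕ∞) (fun ξ => (q (-ξ) : ℂ) * F (-ξ)) := by
    refine (Complex.ofRealCLM.contDiff.comp hqn).mul ((F.smooth _).comp contDiff_neg)
  have hH1 : HasCompactSupport (fun ξ => (q (-ξ) : ℂ) * F (-ξ)) := by
    refine HasCompactSupport.mul_right ?_
    exact hqcn.comp_left (g := fun r : ℝ => (r : ℂ)) Complex.ofReal_zero
  obtain ⟨G, hG, hGinv⟩ := exists_schwartz_ftr (hH1.toSchwartzMap hH2)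
  have h1 : fmult q f = G := by
    rw [hG, fmult, iftr_eq_ftr_comp_neg, ← hF]
    rfl
  refine ⟨?_, h1 ▸ G.integrable⟩
  unfold fmult at h1 ⊢
  congr 1
  ext ξ
  rw [h1, hGinv, ← hF]
  by_cases h : p ξ = 0
  · simp [h]
  · simp [hpq ξ h]

/-- Moments of the kernel against a character vanish when the symbol vanishes near its frequency. -/
lemma integral_ftr_mul_exp_mul_multilinear {g : 𝓢(V3, ℂ)} {θ : V3} (hθ : g =ᶠ[𝓝 θ] 0) {l : ℕ}
    (A : ContinuousMultilinearMap ℝ (fun _ : Fin l => V3) ℂ) :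
    ∫ z, ftr g z * Complex.exp ((2 * Real.pi * Complex.I) * (dot3 θ z : ℂ)) * A (fun _ => z) = 0 := by
  obtain ⟨G, hG, hGinv⟩ := exists_schwartz_ftr g
  rw [← hG]
  have hint : ∀ n : ℕ, Integrable (fun v ↦ ‖v‖ ^ n * ‖G v‖) := fun n => G.integrable_pow_mul _ n
  have hpint : Integrable (fun v ↦ VectorFourier.fourierPowSMulRight dotCLM G v l) :=
    VectorFourier.integrable_fourierPowSMulRight _ (hint l) G.continuous.aestronglyMeasurable
  have hder := VectorFourier.iteratedFDeriv_fourierIntegral (μ := volume) (N := ⊤) dotCLM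
    (fun n _ => hint n) G.continuous.aestronglyMeasurable (n := l) le_top
  rw [← ftr_eq_vectorFourier] at hder
  have hz : ftr G =ᶠ[𝓝 (-θ)] 0 := by
    have : Tendsto (fun ξ : V3 => -ξ) (𝓝 (-θ)) (𝓝 θ) := by
      simpa using (continuous_neg (G := V3)).tendsto (-θ)
    filter_upwards [this.eventually hθ] with ξ hξ
    rw [hGinv]
    exact hξ
  have hzero : iteratedFDeriv ℝ l (ftr G) (-θ) = 0 := by
    rw [(hz.iteratedFDeriv ℝ l).eq_of_nhds]
    simp
  rw [hder] at hzero
  have hmono : ∀ b : Fin l → V3, ∫ z, G z *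
      Complex.exp ((2 * Real.pi * Complex.I) * (dot3 θ z : ℂ)) * ((∏ a, dot3 z (b a) : ℝ) : ℂ) = 0 := by
    intro b
    have h := congrArg (fun T => T b) hzero
    simp only [zero_apply] at h
    rw [Real.fourierIntegral_continuousMultilinearMap_apply' hpint] at h
    simp only [VectorFourier.fourierIntegral, VectorFourier.fourierPowSMulRight_apply,
      Circle.smul_def, Real.fourierChar_apply, smul_eq_mul, Complex.real_smul] at h
    have hc : (-(2 * (Real.pi : ℂ) * Complex.I)) ^ l ≠ 0 := by
      simp [Real.pi_ne_zero]
    refine (mul_right_injective₀ hc) ?_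
    simp only
    rw [← integral_const_mul, mul_zero, ← h]
    congr with z
    have e1 : (dotCLM.toLinearMap₁₂ z) (-θ) = - dot3 θ z := by
      rw [map_neg, dot3_comm]; rfl
    rw [e1]
    simp only [dotCLM_apply, neg_neg]
    push_cast
    ring_nf
  have hexp : ∀ z : V3, A (fun _ => z)
      = ∑ r : Fin l → Fin 3, ((∏ a, dot3 z (e3 (r a)) : ℝ) : ℂ) * A (fun a => e3 (r a)) := by
    intro z
    have hz : z = ∑ i, dot3 z (e3 i) • e3 i := by
      ext j
      simp [dot3, e3]
    conv_lhs => rw [hz]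
    rw [A.map_sum]
    refine Finset.sum_congr rfl fun r _ => ?_
    rw [A.map_smul_univ, Complex.real_smul]
  simp only [hexp, Finset.mul_sum]
  have hi : ∀ r : Fin l → Fin 3, Integrable fun z => G z *
      Complex.exp ((2 * Real.pi * Complex.I) * (dot3 θ z : ℂ)) * (((∏ a, dot3 z (e3 (r a)) : ℝ) : ℂ) *
        A (fun a => e3 (r a))) := by
    intro r
    refine ((hint l).mul_const ‖A (fun a => e3 (r a))‖).mono' ?_ (Eventually.of_forall fun z => ?_)
    · refine Continuous.aestronglyMeasurable ?_
      have := G.continuous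
      unfold dot3
      fun_prop
    · have h1 : ‖((∏ a, dot3 z (e3 (r a)) : ℝ) : ℂ)‖ ≤ ‖z‖ ^ l := by
        rw [Complex.norm_real, norm_prod]
        refine (Finset.prod_le_prod (g := fun _ => ‖z‖) (fun _ _ => norm_nonneg _)
          fun a _ => ?_).trans (by simp)
        simpa [dot3, e3] using norm_le_pi_norm z (r a)
      have h2 : ‖Complex.exp ((2 * Real.pi * Complex.I) * (dot3 θ z : ℂ))‖ = 1 := by
        rw [Complex.norm_exp]; simp
      rw [norm_mul, norm_mul, norm_mul, h2, mul_one, mul_comm (‖z‖ ^ l), mul_assoc]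
      gcongr
  rw [integral_finsetSum _ fun r _ => hi r]
  refine Finset.sum_eq_zero fun r _ => ?_
  simp only [← mul_assoc]
  rw [integral_mul_const, hmono, zero_mul]

/-- Taylor's formula on `[0, 1]` with remainder controlled by the oscillation of the top derivative. -/
lemma norm_sub_taylor_le {n : ℕ} {H : ℝ} {g : ℕ → ℝ → ℂ}
    (hg : ∀ l t, HasDerivAt (g l) (g (l + 1) t) t)
    (hH : ∀ t ∈ Set.Icc (0 : ℝ) 1, ‖g n t - g n 0‖ ≤ H) :
    ∀ t ∈ Set.Icc (0 : ℝ) 1,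
      ‖g 0 t - ∑ l ∈ Finset.range (n + 1), (t ^ l / (l.factorial : ℝ)) • g l 0‖ ≤ H := by
  induction n generalizing g with
  | zero => simpa using hH
  | succ n ih =>
    intro t ht
    have ih' := ih (g := fun l => g (l + 1)) (fun l t => hg (l + 1) t) hH
    have hder : ∀ t : ℝ, HasDerivAt
        (fun t : ℝ => g 0 t - ∑ l ∈ Finset.range (n + 1 + 1), (t ^ l / (l.factorial : ℝ)) • g l 0)
        (g 1 t - ∑ l ∈ Finset.range (n + 1), (t ^ l / (l.factorial : ℝ)) • g (l + 1) 0) t := by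
      intro t
      refine (hg 0 t).sub ?_
      simp_rw [Finset.sum_range_succ' _ (n + 1)]
      simp only [pow_zero, Nat.factorial_zero, Nat.cast_one, div_one, one_smul]
      refine HasDerivAt.add_const _ ?_
      refine HasDerivAt.fun_sum fun l _ => ?_
      have h := (((hasDerivAt_pow (l + 1) t).div_const ((l + 1).factorial : ℝ)).smul_const
        (g (l + 1) 0))
      convert h using 2
      rw [Nat.factorial_succ]
      push_cast
      have : (l.factorial : ℝ) ≠ 0 := by positivity
      have : (l : ℝ) + 1 ≠ 0 := by positivity
      field_simp
    have hH0 : 0 ≤ H := (norm_nonneg _).trans (hH 0 (by simp))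
    have := norm_image_sub_le_of_norm_deriv_le_segment' (a := 0) (b := 1)
      (fun t _ => (hder t).hasDerivWithinAt)
      (fun t ht => ih' t (Set.Ico_subset_Icc_self ht)) t ht
    rw [Finset.sum_range_succ' (fun l => ((0 : ℝ) ^ l / (l.factorial : ℝ)) • g l 0)] at this
    simp only [zero_pow (Nat.succ_ne_zero _), zero_div, zero_smul, Finset.sum_const_zero, zero_add,
      pow_zero, Nat.factorial_zero, Nat.cast_one, div_one, one_smul, sub_self, sub_zero] at this
    exact this.trans (mul_le_of_le_one_right hH0 ht.2)

lemma norm_sub_multilinear_taylor_le {E : Type*} [NormedAddCommGroup E] [NormedSpace ℝ E]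
    {F : E → ℂ} (hF : ContDiff ℝ (⊤ : ℕ∞) F) (n : ℕ) (x w : E) {H : ℝ}
    (hH : ∀ t ∈ Set.Icc (0 : ℝ) 1,
      ‖iteratedFDeriv ℝ n F (x + t • w) - iteratedFDeriv ℝ n F x‖ ≤ H) :
    ‖F (x + w) - ∑ l ∈ Finset.range (n + 1),
      ((l.factorial : ℝ)⁻¹) • iteratedFDeriv ℝ l F x (fun _ => w)‖ ≤ H * ‖w‖ ^ n := by
  have hder : ∀ (l : ℕ) (t : ℝ), HasDerivAt
      (fun t : ℝ => iteratedFDeriv ℝ l F (x + t • w) (fun _ => w))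
      (iteratedFDeriv ℝ (l + 1) F (x + t • w) (fun _ => w)) t := by
    intro l t
    have h1 : HasDerivAt (fun t : ℝ => x + t • w) w t := by
      simpa using ((hasDerivAt_id t).smul_const w).const_add x
    have h2 : HasFDerivAt (iteratedFDeriv ℝ l F) (fderiv ℝ (iteratedFDeriv ℝ l F) (x + t • w))
        (x + t • w) :=
      ((hF.differentiable_iteratedFDeriv (by exact_mod_cast ENat.natCast_lt_top l)) _).hasFDerivAt
    have h3 := h2.comp_hasDerivAt t h1
    have h4 := ((ContinuousMultilinearMap.apply ℝ (fun _ : Fin l => E) ℂ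
      (fun _ => w)).hasFDerivAt).comp_hasDerivAt t h3
    exact h4
  have := norm_sub_taylor_le (n := n) (H := H * ‖w‖ ^ n) hder (fun t ht => by
    simp only [zero_smul, add_zero]
    rw [← sub_apply]
    refine ((iteratedFDeriv ℝ n F (x + t • w) - iteratedFDeriv ℝ n F x).le_opNorm _).trans ?_
    simp only [Finset.prod_const, Finset.card_univ, Fintype.card_fin]
    gcongr
    exact hH t ht) 1 (by simp)
  simpa using this

lemma sum_norm_le_of_ncard_le {ι E : Type*} [Fintype ι] [NormedAddCommGroup E] {a : ι → E}
    {S : Set ι} {N : ℕ} {B : ℝ} (hB : 0 ≤ B) (hS : S.ncard ≤ N) (h0 : ∀ j ∉ S, a j = 0)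
    (ha : ∀ j, ‖a j‖ ≤ B) : ∑ j, ‖a j‖ ≤ N * B := by
  classical
  rw [← Finset.sum_subset (Finset.subset_univ S.toFinset)
    (fun j _ hj => by rw [h0 j (by simpa using hj), norm_zero])]
  refine (Finset.sum_le_card_nsmul _ _ B fun j _ => ha j).trans ?_
  rw [nsmul_eq_mul, ← Set.ncard_eq_toFinset_card']
  gcongr

lemma bddAbove_norm_of_hasCompactSupport {E : Type*} [NormedAddCommGroup E] {g : V3 → E}
    (hg : Continuous g) (hgc : HasCompactSupport g) : BddAbove (Set.range fun x => ‖g x‖) :=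
  hg.norm.bddAbove_range_of_hasCompactSupport hgc.norm

lemma norm_le_C0Norm {c : V3 → ℂ} (hc : Continuous c) (hcc : HasCompactSupport c) (x : V3) :
    ‖c x‖ ≤ C0Norm c :=
  le_ciSup (bddAbove_norm_of_hasCompactSupport hc hcc) x

lemma C0Norm_nonneg {E : Type*} [NormedAddCommGroup E] (c : V3 → E) : 0 ≤ C0Norm c :=
  Real.iSup_nonneg fun _ => norm_nonneg _

lemma C0Norm_le {E : Type*} [NormedAddCommGroup E] {f : V3 → E} {B : ℝ} (hB : 0 ≤ B)
    (h : ∀ x, ‖f x‖ ≤ B) : C0Norm f ≤ B :=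
  Real.iSup_le h hB

lemma hsemi_nonneg {E : Type*} [NormedAddCommGroup E] (τ : ℝ) (g : V3 → E) : 0 ≤ hsemi τ g := by
  refine Real.iSup_nonneg fun p => ?_
  split_ifs
  · exact le_rfl
  · exact div_nonneg (norm_nonneg _) (Real.rpow_nonneg (norm3_nonneg _) _)

lemma CsNorm_nonneg (σ : ℝ) (c : V3 → ℂ) : 0 ≤ CsNorm σ c :=
  add_nonneg (Finset.sum_nonneg fun _ _ => Real.iSup_nonneg fun _ => norm_nonneg _)
    (hsemi_nonneg _ _)

lemma norm_sub_le_hsemi {E : Type*} [NormedAddCommGroup E] [NormedSpace ℝ E] {g : V3 → E}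
    (hg : ContDiff ℝ 1 g) (hgc : HasCompactSupport g) {τ : ℝ} (hτ0 : 0 ≤ τ) (hτ1 : τ ≤ 1)
    (x y : V3) : ‖g x - g y‖ ≤ hsemi τ g * norm3 (x - y) ^ τ := by
  obtain ⟨K, hK⟩ := hg.lipschitzWith_of_hasCompactSupport hgc one_ne_zero
  obtain ⟨M, hM⟩ := bddAbove_norm_of_hasCompactSupport hg.continuous hgc
  have hM' : ∀ z, ‖g z‖ ≤ M := fun z => hM ⟨z, rfl⟩
  have hM0 : 0 ≤ M := (norm_nonneg _).trans (hM' 0)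
  have hpos : ∀ {a b : V3}, a ≠ b → 0 < norm3 (a - b) := fun {a b} hab =>
    (norm_pos_iff.2 (sub_ne_zero.2 hab)).trans_le (norm_le_norm3 _)
  have hbdd : BddAbove (Set.range fun p : V3 × V3 =>
      open Classical in
      if p.1 = p.2 then (0 : ℝ) else ‖g p.1 - g p.2‖ / norm3 (p.1 - p.2) ^ τ) := by
    refine ⟨K + 2 * M, ?_⟩
    rintro _ ⟨p, rfl⟩
    simp only
    split_ifs with h
    · positivity
    have hd := hpos h
    rw [div_le_iff₀ (Real.rpow_pos_of_pos hd _)]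
    rcases le_total (norm3 (p.1 - p.2)) 1 with h1 | h1
    · have e1 : norm3 (p.1 - p.2) ≤ norm3 (p.1 - p.2) ^ τ := by
        simpa using Real.rpow_le_rpow_of_exponent_ge hd h1 hτ1
      calc ‖g p.1 - g p.2‖ ≤ K * ‖p.1 - p.2‖ := hK.norm_sub_le _ _
        _ ≤ K * norm3 (p.1 - p.2) := by gcongr; exact norm_le_norm3 _
        _ ≤ (K + 2 * M) * norm3 (p.1 - p.2) ^ τ := by
          gcongr
          linarith
    · have e1 : 1 ≤ norm3 (p.1 - p.2) ^ τ := Real.one_le_rpow h1 hτ0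
      calc ‖g p.1 - g p.2‖ ≤ M + M := (norm_sub_le _ _).trans (add_le_add (hM' _) (hM' _))
        _ ≤ (K + 2 * M) * 1 := by linarith [K.coe_nonneg]
        _ ≤ _ := by gcongr
  rcases eq_or_ne x y with rfl | hxy
  · simpa using mul_nonneg (hsemi_nonneg τ g) (Real.rpow_nonneg (norm3_nonneg _) _)
  · rw [← div_le_iff₀ (Real.rpow_pos_of_pos (hpos hxy) _)]
    exact (by simp [hxy] : _ = _).trans_le (le_ciSup hbdd (x, y))

lemma norm_iteratedFDeriv_sub_le_CsNorm {c : V3 → ℂ} (hc : ContDiff ℝ (⊤ : ℕ∞) c)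
    (hcc : HasCompactSupport c) {σ : ℝ} (hσ : 0 ≤ σ) (x y : V3) :
    ‖iteratedFDeriv ℝ ⌊σ⌋₊ c x - iteratedFDeriv ℝ ⌊σ⌋₊ c y‖
      ≤ CsNorm σ c * norm3 (x - y) ^ (σ - ⌊σ⌋₊) := by
  have h1 : ContDiff ℝ 1 (iteratedFDeriv ℝ ⌊σ⌋₊ c) :=
    hc.iteratedFDeriv_right (m := 1) (by exact_mod_cast le_top)
  refine (norm_sub_le_hsemi h1 (hcc.iteratedFDeriv _) (sub_nonneg.2 (Nat.floor_le hσ))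
    (by linarith [Nat.lt_floor_add_one σ]) x y).trans ?_
  gcongr
  · exact Real.rpow_nonneg (norm3_nonneg _) _
  · exact le_add_of_nonneg_left
      (Finset.sum_nonneg fun _ _ => Real.iSup_nonneg fun _ => norm_nonneg _)

/-- The oscillating sum `∑ⱼ cⱼ(x) exp(i λ kⱼ·x)`. -/
def oscSum {J : ℕ} (c : Fin J → V3 → ℂ) (k : Fin J → V3) (lamb : ℝ) (x : V3) : ℂ :=
  ∑ j : Fin J, c j x * Complex.exp (Complex.I * lamb * (dot3 (k j) x : ℂ))

/-- Taylor remainder of a superposition of functions with bounded overlap. -/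
lemma norm_sum_taylor_remainder_le {J N : ℕ} {c : Fin J → V3 → ℂ}
    (hc : ∀ j, ContDiff ℝ (⊤ : ℕ∞) (c j)) (hcc : ∀ j, HasCompactSupport (c j))
    (hN : ∀ x : V3, Set.ncard {j : Fin J | x ∈ tsupport (c j)} ≤ N)
    {σ B : ℝ} (hσ : 0 ≤ σ) (hB0 : 0 ≤ B) (hB : ∀ j, CsNorm σ (c j) ≤ B) {u : Fin J → ℂ}
    (hu : ∀ j, ‖u j‖ = 1) (x w : V3) :
    ‖∑ j, u j * (c j (x + w) - ∑ l ∈ Finset.range (⌊σ⌋₊ + 1),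
        ((l.factorial : ℝ)⁻¹) • iteratedFDeriv ℝ l (c j) x (fun _ => w))‖
      ≤ 4 * N * B * ‖w‖ ^ σ := by
  set n := ⌊σ⌋₊ with hn
  set τ := σ - n with hτ
  have hτ0 : 0 ≤ τ := sub_nonneg.2 (Nat.floor_le hσ)
  have hτ1 : τ ≤ 1 := by linarith [Nat.lt_floor_add_one σ]
  let F : V3 → ℂ := fun y => ∑ j, u j • c j y
  have hF : ContDiff ℝ (⊤ : ℕ∞) F := ContDiff.sum fun j _ => (hc j).const_smul (u j)
  have hFd : ∀ (l : ℕ) (y : V3), iteratedFDeriv ℝ l F y = ∑ j, u j • iteratedFDeriv ℝ l (c j) y := by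
    intro l y
    have h1 : ∀ j ∈ (Finset.univ : Finset (Fin J)), ContDiff ℝ l (fun y => u j • c j y) :=
      fun j _ => ((hc j).of_le (by exact_mod_cast le_top)).const_smul (u j)
    simp only [F]
    rw [iteratedFDeriv_fun_sum_apply (fun j hj => (h1 j hj).contDiffAt)]
    refine Finset.sum_congr rfl fun j _ => ?_
    exact iteratedFDeriv_const_smul_apply' ((hc j).of_le (by exact_mod_cast le_top)).contDiffAt
  have hosc : ∀ t ∈ Set.Icc (0 : ℝ) 1,
      ‖iteratedFDeriv ℝ n F (x + t • w) - iteratedFDeriv ℝ n F x‖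
        ≤ (2 * N : ℕ) * (B * (2 * ‖w‖ ^ τ)) := by
    intro t ht
    rw [hFd, hFd, ← Finset.sum_sub_distrib]
    simp only [← smul_sub]
    refine (norm_sum_le _ _).trans ?_
    refine sum_norm_le_of_ncard_le
      (S := {j | x + t • w ∈ tsupport (c j)} ∪ {j | x ∈ tsupport (c j)}) (by positivity) ?_ ?_ ?_
    · exact (Set.ncard_union_le _ _).trans (by linarith [hN x, hN (x + t • w)])
    · intro j hj
      simp only [Set.mem_union, Set.mem_ofPred_eq, not_or] at hj
      have hz : ∀ y, y ∉ tsupport (c j) → iteratedFDeriv ℝ n (c j) y = 0 := fun y hy =>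
        Function.notMem_support.1 fun h => hy (support_iteratedFDeriv_subset n h)
      rw [hz _ hj.1, hz _ hj.2, sub_zero, smul_zero]
    · intro j
      rw [norm_smul, hu, one_mul]
      refine (norm_iteratedFDeriv_sub_le_CsNorm (hc j) (hcc j) hσ _ _).trans ?_
      have h1 : norm3 (x + t • w - x) ≤ 2 * ‖w‖ := by
        rw [add_sub_cancel_left, norm3_smul, abs_of_nonneg ht.1]
        exact (mul_le_of_le_one_left (norm3_nonneg _) ht.2).trans (norm3_le w)
      have h2 : norm3 (x + t • w - x) ^ τ ≤ 2 * ‖w‖ ^ τ :=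
        calc norm3 (x + t • w - x) ^ τ ≤ (2 * ‖w‖) ^ τ :=
              Real.rpow_le_rpow (norm3_nonneg _) h1 hτ0
          _ = 2 ^ τ * ‖w‖ ^ τ := Real.mul_rpow (by norm_num) (norm_nonneg _)
          _ ≤ 2 * ‖w‖ ^ τ := by
            gcongr
            simpa using Real.rpow_le_rpow_of_exponent_le (one_le_two (α := ℝ)) hτ1
      exact mul_le_mul (hB j) h2 (Real.rpow_nonneg (norm3_nonneg _) _) hB0
  have key := norm_sub_multilinear_taylor_le hF n x w hosc
  have e1 : F (x + w) - ∑ l ∈ Finset.range (n + 1),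
      ((l.factorial : ℝ)⁻¹) • iteratedFDeriv ℝ l F x (fun _ => w)
      = ∑ j, u j * (c j (x + w) - ∑ l ∈ Finset.range (n + 1),
        ((l.factorial : ℝ)⁻¹) • iteratedFDeriv ℝ l (c j) x (fun _ => w)) := by
    simp only [hFd, mul_sub, Finset.sum_sub_distrib]
    congr 1
    simp only [sum_apply, smul_apply, Finset.smul_sum, Finset.mul_sum]
    rw [Finset.sum_comm]
    refine Finset.sum_congr rfl fun j _ => Finset.sum_congr rfl fun l _ => ?_
    simp only [smul_eq_mul, Complex.real_smul]
    ring
  rw [e1] at key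
  refine key.trans (le_of_eq ?_)
  have e2 : ‖w‖ ^ σ = ‖w‖ ^ τ * ‖w‖ ^ n := by
    rw [← Real.rpow_natCast, ← Real.rpow_add_of_nonneg (norm_nonneg _) hτ0 (Nat.cast_nonneg _)]
    congr 1
    simp [hτ]
  rw [e2]
  push_cast
  ring

lemma integrable_ftr_mul_exp_mul_multilinear (G : 𝓢(V3, ℂ)) (θ : V3) {l : ℕ}
    (A : ContinuousMultilinearMap ℝ (fun _ : Fin l => V3) ℂ) :
    Integrable fun z => G z * Complex.exp ((2 * Real.pi * Complex.I) * (dot3 θ z : ℂ)) *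
      A (fun _ => z) := by
  refine ((G.integrable_pow_mul volume l).mul_const ‖A‖).mono' ?_ (Eventually.of_forall fun z => ?_)
  · refine Continuous.aestronglyMeasurable ?_
    have := G.continuous
    have h2 : Continuous fun z : V3 => A (fun _ => z) := A.cont.comp (by fun_prop)
    unfold dot3
    fun_prop
  · have h2 : ‖Complex.exp ((2 * Real.pi * Complex.I) * (dot3 θ z : ℂ))‖ = 1 := by
      rw [Complex.norm_exp]; simp
    rw [norm_mul, norm_mul, h2, mul_one, mul_comm (‖z‖ ^ l), mul_assoc]
    gcongr
    simpa [mul_comm] using A.le_opNorm (fun _ => z)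

lemma exists_schwartz_symbol {ψ : V3 → ℝ} (hψ : ContDiff ℝ (⊤ : ℕ∞) ψ) (hψc : HasCompactSupport ψ) :
    ∃ g : 𝓢(V3, ℂ), ⇑g = fun ξ => (ψ ξ : ℂ) :=
  ⟨(hψc.comp_left (g := fun r : ℝ => (r : ℂ)) Complex.ofReal_zero).toSchwartzMap
    (Complex.ofRealCLM.contDiff.comp hψ), rfl⟩

lemma norm_exp_I_mul (a b : ℝ) : ‖Complex.exp (Complex.I * a * (b : ℂ))‖ = 1 := by
  rw [Complex.norm_exp]; simp

/-- Dilated multipliers with a smooth compactly supported symbol are uniformly bounded on `L^∞`. -/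
lemma exists_norm_fmult_dilate_le {ψ : V3 → ℝ} (hψ : ContDiff ℝ (⊤ : ℕ∞) ψ)
    (hψc : HasCompactSupport ψ) :
    ∃ C : ℝ, 0 ≤ C ∧ ∀ (f : V3 → ℂ), Integrable f → ∀ B : ℝ, (∀ x, ‖f x‖ ≤ B) →
      ∀ R : ℝ, 0 < R → ∀ x, ‖fmult (fun ξ => ψ (R⁻¹ • ξ)) f x‖ ≤ C * B := by
  obtain ⟨g, hg⟩ := exists_schwartz_symbol hψ hψc
  obtain ⟨G, hG, -⟩ := exists_schwartz_ftr g
  refine ⟨∫ z, ‖G z‖, integral_nonneg fun _ => norm_nonneg _, fun f hf B hB R hR x => ?_⟩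
  rw [fmult_dilate_eq_integral (hg ▸ g.integrable) hf hR, ← hg, ← hG, ← integral_mul_const]
  refine norm_integral_le_of_norm_le (G.integrable.norm.mul_const B)
    (Eventually.of_forall fun z => ?_)
  rw [norm_mul]
  gcongr
  exact hB _

section OscillatingSum

variable {J : ℕ} {c : Fin J → V3 → ℂ} {k : Fin J → V3} {lamb : ℝ}

lemma contDiff_oscSum (hc : ∀ j, ContDiff ℝ (⊤ : ℕ∞) (c j)) :
    ContDiff ℝ (⊤ : ℕ∞) (oscSum c k lamb) := by
  have h : ∀ j, ContDiff ℝ (⊤ : ℕ∞) fun x => dot3 (k j) x := fun j => by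
    unfold dot3
    fun_prop
  exact ContDiff.sum fun j _ => (hc j).mul
    (ContDiff.cexp (contDiff_const.mul (Complex.ofRealCLM.contDiff.comp (h j))))

lemma hasCompactSupport_oscSum (hcc : ∀ j, HasCompactSupport (c j)) :
    HasCompactSupport (oscSum c k lamb) := by
  have h : oscSum c k lamb =
      ∑ j, fun x => c j x * Complex.exp (Complex.I * lamb * (dot3 (k j) x : ℂ)) := by
    ext x
    simp [oscSum]
  rw [h]
  exact Finset.sum_induction _ HasCompactSupport (fun _ _ => HasCompactSupport.add)
    HasCompactSupport.zero fun j _ => (hcc j).mul_right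

lemma norm_oscSum_le {N : ℕ} (hN : ∀ x : V3, Set.ncard {j : Fin J | x ∈ tsupport (c j)} ≤ N)
    {B : ℝ} (hB0 : 0 ≤ B) (hB : ∀ j x, ‖c j x‖ ≤ B) (x : V3) : ‖oscSum c k lamb x‖ ≤ N * B := by
  refine (norm_sum_le _ _).trans (sum_norm_le_of_ncard_le hB0 (hN x) (fun j hj => ?_) fun j => ?_)
  · rw [image_eq_zero_of_notMem_tsupport hj, zero_mul]
  · rw [norm_mul, norm_exp_I_mul, mul_one]
    exact hB j x

end OscillatingSum

/-- A multiplier at scale `R` whose symbol vanishes near all the frequencies of an oscillating sum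
gains `R^{-σ}` against the `C^σ` norms of the amplitudes. -/
lemma exists_norm_fmult_oscSum_le {ψ : V3 → ℝ} (hψ : ContDiff ℝ (⊤ : ℕ∞) ψ)
    (hψc : HasCompactSupport ψ) {σ : ℝ} (hσ : 0 ≤ σ) :
    ∃ C : ℝ, 0 ≤ C ∧ ∀ (J N : ℕ) (c : Fin J → V3 → ℂ) (k : Fin J → V3) (lamb : ℝ),
      (∀ j, ContDiff ℝ (⊤ : ℕ∞) (c j)) → (∀ j, HasCompactSupport (c j)) →
      (∀ x : V3, Set.ncard {j : Fin J | x ∈ tsupport (c j)} ≤ N) →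
      ∀ B : ℝ, 0 ≤ B → (∀ j, CsNorm σ (c j) ≤ B) → ∀ R : ℝ, 0 < R →
      (∀ j, ψ =ᶠ[𝓝 ((lamb / (2 * Real.pi * R)) • k j)] 0) →
      ∀ x, ‖fmult (fun ξ => ψ (R⁻¹ • ξ)) (oscSum c k lamb) x‖ ≤ C * (N * (R ^ (-σ) * B)) := by
  obtain ⟨g, hg⟩ := exists_schwartz_symbol hψ hψc
  obtain ⟨G, hG, -⟩ := exists_schwartz_ftr g
  set n := ⌊σ⌋₊ with hn
  have hint : Integrable fun z => 4 * (‖z‖ ^ 0 * ‖G z‖ + ‖z‖ ^ (n + 1) * ‖G z‖) :=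
    ((G.integrable_pow_mul volume 0).add (G.integrable_pow_mul volume (n + 1))).const_mul 4
  refine ⟨∫ z, 4 * (‖z‖ ^ 0 * ‖G z‖ + ‖z‖ ^ (n + 1) * ‖G z‖),
    integral_nonneg fun _ => by positivity, ?_⟩
  intro J N c k lamb hc hcc hN B hB0 hB R hR hvan x
  have hfc : Continuous (oscSum c k lamb) := (contDiff_oscSum hc).continuous
  have hfi : Integrable (oscSum c k lamb) :=
    hfc.integrable_of_hasCompactSupport (hasCompactSupport_oscSum hcc)
  rw [fmult_dilate_eq_integral (hg ▸ g.integrable) hfi hR, ← hg, ← hG]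
  let θ : Fin J → V3 := fun j => (lamb / (2 * Real.pi * R)) • k j
  let e : Fin J → ℂ := fun j => Complex.exp (Complex.I * lamb * (dot3 (k j) x : ℂ))
  let ex : Fin J → V3 → ℂ := fun j z =>
    Complex.exp ((2 * Real.pi * Complex.I) * (dot3 (θ j) z : ℂ))
  let A : (j : Fin J) → (l : ℕ) → ContinuousMultilinearMap ℝ (fun _ : Fin l => V3) ℂ :=
    fun j l => ((l.factorial : ℝ)⁻¹ * R⁻¹ ^ l) • iteratedFDeriv ℝ l (c j) x
  have hex : ∀ j z, ‖e j * ex j z‖ = 1 := by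
    intro j z
    rw [norm_mul, norm_exp_I_mul, Complex.norm_exp]
    simp
  have hf : ∀ z, oscSum c k lamb (x + R⁻¹ • z) = ∑ j, e j * ex j z * c j (x + R⁻¹ • z) := by
    intro z
    refine Finset.sum_congr rfl fun j _ => ?_
    rw [mul_comm]
    congr 1
    simp only [e, ex, θ]
    rw [← Complex.exp_add]
    congr 1
    simp only [dot3, Fin.sum_univ_three, Pi.add_apply, Pi.smul_apply, smul_eq_mul]
    have h1 : (R : ℂ) ≠ 0 := by exact_mod_cast hR.ne'
    have h2 : (Real.pi : ℂ) ≠ 0 := by exact_mod_cast Real.pi_ne_zero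
    push_cast
    field_simp
    ring
  have hA : ∀ j l z, A j l (fun _ => z)
      = ((l.factorial : ℝ)⁻¹) • iteratedFDeriv ℝ l (c j) x (fun _ => R⁻¹ • z) := by
    intro j l z
    have := (iteratedFDeriv ℝ l (c j) x).map_smul_univ (fun _ => R⁻¹) (fun _ => z)
    rw [this]
    simp only [A, smul_apply, Finset.prod_const, Finset.card_univ, Fintype.card_fin, mul_smul]
  have hTi : ∀ j l, Integrable fun z => G z * ex j z * A j l (fun _ => z) := fun j l =>
    integrable_ftr_mul_exp_mul_multilinear G (θ j) (A j l)
  have hT0 : ∀ j l, ∫ z, G z * ex j z * A j l (fun _ => z) = 0 := by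
    intro j l
    rw [hG]
    refine integral_ftr_mul_exp_mul_multilinear ?_ (A j l)
    filter_upwards [hvan j] with ξ hξ
    simp [hg, hξ]
  have hTsi : Integrable fun z => ∑ j, ∑ l ∈ Finset.range (n + 1),
      e j * (G z * ex j z * A j l (fun _ => z)) :=
    integrable_finsetSum _ fun j _ => integrable_finsetSum _ fun l _ => (hTi j l).const_mul _
  have hTs0 : ∫ z, ∑ j, ∑ l ∈ Finset.range (n + 1),
      e j * (G z * ex j z * A j l (fun _ => z)) = 0 := by
    rw [integral_finsetSum _ fun j _ => integrable_finsetSum _ fun l _ => (hTi j l).const_mul _]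
    refine Finset.sum_eq_zero fun j _ => ?_
    rw [integral_finsetSum _ fun l _ => (hTi j l).const_mul _]
    refine Finset.sum_eq_zero fun l _ => ?_
    rw [integral_const_mul, hT0, mul_zero]
  have hGf : Integrable fun z => G z * oscSum c k lamb (x + R⁻¹ • z) := by
    obtain ⟨M, hM⟩ := bddAbove_norm_of_hasCompactSupport hfc (hasCompactSupport_oscSum hcc)
    refine G.integrable.mul_bdd (c := M) ?_ (Eventually.of_forall fun z => hM ⟨_, rfl⟩)
    exact (hfc.comp (by fun_prop)).aestronglyMeasurable
  rw [← sub_zero (∫ z, _), ← hTs0, ← integral_sub hGf hTsi, ← integral_mul_const]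
  refine norm_integral_le_of_norm_le (hint.mul_const _) (Eventually.of_forall fun z => ?_)
  have hre : G z * oscSum c k lamb (x + R⁻¹ • z) - ∑ j, ∑ l ∈ Finset.range (n + 1),
      e j * (G z * ex j z * A j l (fun _ => z))
      = G z * ∑ j, e j * ex j z * (c j (x + R⁻¹ • z) - ∑ l ∈ Finset.range (n + 1),
        ((l.factorial : ℝ)⁻¹) • iteratedFDeriv ℝ l (c j) x (fun _ => R⁻¹ • z)) := by
    simp only [← hA, hf, Finset.mul_sum, ← Finset.sum_sub_distrib, mul_sub]
    refine Finset.sum_congr rfl fun j _ => ?_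
    congr 1
    refine Finset.sum_congr rfl fun l _ => ?_
    ring
  rw [hre, norm_mul]
  refine (mul_le_mul_of_nonneg_left (norm_sum_taylor_remainder_le hc hcc hN hσ hB0 hB
    (fun j => hex j z) x (R⁻¹ • z)) (norm_nonneg _)).trans ?_
  have h1 : ‖R⁻¹ • z‖ ^ σ = R ^ (-σ) * ‖z‖ ^ σ := by
    rw [norm_smul, Real.norm_of_nonneg (inv_nonneg.2 hR.le),
      Real.mul_rpow (inv_nonneg.2 hR.le) (norm_nonneg _), Real.inv_rpow hR.le,
      Real.rpow_neg hR.le]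
  have h2 : ‖z‖ ^ σ ≤ 1 + ‖z‖ ^ (n + 1) := by
    rcases le_total ‖z‖ 1 with h | h
    · have := Real.rpow_le_one (norm_nonneg z) h hσ
      have : 0 ≤ ‖z‖ ^ (n + 1) := by positivity
      linarith
    · have := Real.rpow_le_rpow_of_exponent_le h (Nat.lt_floor_add_one σ).le
      have h3 : ‖z‖ ^ ((⌊σ⌋₊ : ℝ) + 1) = ‖z‖ ^ (n + 1) := by
        rw [← Real.rpow_natCast]
        push_cast
        rfl
      linarith
  have hR0 : 0 ≤ R ^ (-σ) := Real.rpow_nonneg hR.le _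
  calc ‖G z‖ * (4 * N * B * ‖R⁻¹ • z‖ ^ σ)
      = (4 * ‖G z‖ * (N * (R ^ (-σ) * B))) * ‖z‖ ^ σ := by rw [h1]; ring
    _ ≤ (4 * ‖G z‖ * (N * (R ^ (-σ) * B))) * (1 + ‖z‖ ^ (n + 1)) := by gcongr
    _ = _ := by ring

lemma rpow_le_of_comparable {x y K : ℝ} (s : ℝ) (hx : 0 < x) (hy : 0 < y) (hK : 1 ≤ K)
    (hxy : x ≤ K * y) (hyx : y ≤ K * x) : x ^ s ≤ K ^ |s| * y ^ s := by
  have hK0 : 0 < K := by linarith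
  rcases le_total 0 s with hs | hs
  · rw [abs_of_nonneg hs, ← Real.mul_rpow hK0.le hy.le]
    exact Real.rpow_le_rpow hx.le hxy hs
  · rw [abs_of_nonpos hs, Real.rpow_neg hK0.le, ← Real.inv_rpow hK0.le,
      ← Real.mul_rpow (inv_nonneg.2 hK0.le) hy.le]
    refine Real.rpow_le_rpow_of_nonpos (by positivity) ?_ hs
    rwa [inv_mul_le_iff₀ hK0]

lemma hasCompactSupport_of_norm3 {ψ : V3 → ℝ} {r : ℝ} (h : ∀ ξ, ¬ norm3 ξ < r → ψ ξ = 0) :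
    HasCompactSupport ψ := by
  refine HasCompactSupport.intro (isCompact_closedBall (0 : V3) r) fun ξ hξ => h ξ fun hlt => hξ ?_
  rw [mem_closedBall_zero_iff]
  exact (norm_le_norm3 ξ).trans hlt.le

lemma LPpair.low_eq_one {χ φ : V3 → ℝ} (h : LPpair χ φ) {ξ : V3} (hξ : norm3 ξ ≤ 3 / 4) :
    χ ξ = 1 := by
  have h0 : ∀ N : ℕ, φ ((2:ℝ) ^ (-(N:ℤ)) • ξ) = 0 := by
    intro N
    refine h.suppAnn _ fun hc => ?_
    have h1 : (2:ℝ) ^ (-(N:ℤ)) ≤ 1 := by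
      rw [zpow_neg, zpow_natCast]
      exact inv_le_one_of_one_le₀ (one_le_pow₀ one_le_two)
    have h2 : 0 ≤ (2:ℝ) ^ (-(N:ℤ)) := by positivity
    have h3 := hc.1
    rw [norm3_smul, abs_of_nonneg h2] at h3
    nlinarith [norm3_nonneg ξ]
  have h1 := h.partition ξ
  rwa [tsum_congr h0, tsum_zero, add_zero] at h1

/-- At scales well below the oscillation frequency, a multiplier gains `λ^{-σ}`. -/
lemma exists_norm_fmult_oscSum_low_le {χ φ : V3 → ℝ} (hLP : LPpair χ φ) {ψ : V3 → ℝ}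
    (hψ : ContDiff ℝ (⊤ : ℕ∞) ψ) (hsupp : ∀ ξ, ¬ norm3 ξ < 8 / 3 → ψ ξ = 0)
    {σ : ℝ} (hσ : 0 ≤ σ) {K : ℝ} (hK : 1 ≤ K) :
    ∃ C : ℝ, 0 ≤ C ∧ ∀ (J N : ℕ) (c : Fin J → V3 → ℂ) (k : Fin J → V3) (lamb : ℝ),
      (∀ j, ContDiff ℝ (⊤ : ℕ∞) (c j)) → (∀ j, HasCompactSupport (c j)) →
      (∀ x : V3, Set.ncard {j : Fin J | x ∈ tsupport (c j)} ≤ N) →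
      (∀ j, K⁻¹ ≤ norm3 (k j)) → 0 < lamb →
      ∀ B : ℝ, 0 ≤ B → (∀ j, CsNorm σ (c j) ≤ B) → ∀ R : ℝ, 0 < R → 40 * K * R ≤ lamb →
      ∀ x, ‖fmult (fun ξ => ψ (R⁻¹ • ξ)) (oscSum c k lamb) x‖
        ≤ C * (N * (lamb ^ (-σ) * B)) := by
  have hK0 : 0 < K := by linarith
  have hχc : HasCompactSupport χ := hasCompactSupport_of_norm3 hLP.suppLow
  obtain ⟨C, hC0, hC⟩ := exists_norm_fmult_dilate_le hψ (hasCompactSupport_of_norm3 hsupp)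
  obtain ⟨D, hD0, hD⟩ := exists_norm_fmult_oscSum_le hLP.smooth hχc hσ
  refine ⟨C * (D * (10 * K) ^ σ), by positivity, ?_⟩
  intro J N c k lamb hc hcc hN hk hlamb B hB0 hB R hR hRl x
  set S : ℝ := lamb / (10 * K) with hS
  have hS0 : 0 < S := by positivity
  have hSK : S * (10 * K) = lamb := by rw [hS]; field_simp
  have hQ := hD J N c k lamb hc hcc hN B hB0 hB S hS0 fun j => by
    have hfreq : 4 / 3 < norm3 ((lamb / (2 * Real.pi * S)) • k j) := by
      have h1 : lamb / (2 * Real.pi * S) = 5 * K / Real.pi := by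
        rw [hS]
        field_simp
        ring
      have hpi := Real.pi_pos
      rw [norm3_smul, h1, abs_of_nonneg (by positivity)]
      have h2 : 1 ≤ K * norm3 (k j) := by
        have := mul_le_mul_of_nonneg_left (hk j) hK0.le
        rwa [mul_inv_cancel₀ hK0.ne'] at this
      rw [div_mul_eq_mul_div, lt_div_iff₀ hpi]
      nlinarith [Real.pi_lt_d2]
    filter_upwards [continuous_norm3.continuousAt.eventually_const_lt hfreq] with ξ hξ
    exact hLP.suppLow ξ (not_lt.2 hξ.le)
  let f : 𝓢(V3, ℂ) := (hasCompactSupport_oscSum (k := k) (lamb := lamb) hcc).toSchwartzMap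
    (contDiff_oscSum hc)
  obtain ⟨heq, hint⟩ := fmult_fmult_eq (p := fun ξ => ψ (R⁻¹ • ξ)) (q := fun ξ => χ (S⁻¹ • ξ))
    (hLP.smooth.comp (contDiff_const_smul _))
    (hχc.comp_smul (inv_ne_zero hS0.ne')) (fun ξ hξ => by
      refine hLP.low_eq_one ?_
      have h1 : norm3 (R⁻¹ • ξ) < 8 / 3 := by
        by_contra h
        exact hξ (hsupp _ h)
      rw [norm3_smul, abs_of_pos (inv_pos.2 hR), inv_mul_lt_iff₀ hR] at h1
      rw [norm3_smul, abs_of_pos (inv_pos.2 hS0), inv_mul_le_iff₀ hS0]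
      have : 4 * R ≤ S := by
        rw [hS, le_div_iff₀ (by positivity)]
        linarith
      linarith) f
  have hbound := hC _ hint _ hQ R hR x
  rw [heq] at hbound
  refine hbound.trans_eq ?_
  have hpow : S ^ (-σ) = (10 * K) ^ σ * lamb ^ (-σ) := by
    rw [hS, Real.div_rpow hlamb.le (by positivity), Real.rpow_neg (by positivity : 0 ≤ 10 * K),
      div_inv_eq_mul, mul_comm]
  rw [hpow]
  ring

/-- Weighted bound for the blocks whose scale does not exceed the oscillation frequency. -/
lemma exists_rpow_mul_norm_fmult_oscSum_le {χ φ : V3 → ℝ} (hLP : LPpair χ φ) {ψ : V3 → ℝ}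
    (hψ : ContDiff ℝ (⊤ : ℕ∞) ψ) (hsupp : ∀ ξ, ¬ norm3 ξ < 8 / 3 → ψ ξ = 0)
    (s : ℝ) (m : ℕ) {K : ℝ} (hK : 1 ≤ K) :
    ∃ C : ℝ, 0 ≤ C ∧ ∀ (J N : ℕ) (c : Fin J → V3 → ℂ) (k : Fin J → V3) (lamb : ℝ),
      (∀ j, ContDiff ℝ (⊤ : ℕ∞) (c j)) → (∀ j, HasCompactSupport (c j)) →
      (∀ x : V3, Set.ncard {j : Fin J | x ∈ tsupport (c j)} ≤ N) →
      (∀ j, K⁻¹ ≤ norm3 (k j)) → 1 ≤ lamb →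
      ∀ A B : ℝ, 0 ≤ A → 0 ≤ B → (∀ j, C0Norm (c j) ≤ A) →
      (∀ j, CsNorm (m + max s 0) (c j) ≤ B) → ∀ R : ℝ, 1 ≤ R → R ≤ K * lamb →
      ∀ x, R ^ s * ‖fmult (fun ξ => ψ (R⁻¹ • ξ)) (oscSum c k lamb) x‖
        ≤ C * N * (lamb ^ s * A + lamb ^ (-(m:ℝ)) * B) := by
  have hK0 : 0 < K := by linarith
  obtain ⟨C, hC0, hC⟩ := exists_norm_fmult_dilate_le hψ (hasCompactSupport_of_norm3 hsupp)
  obtain ⟨D, hD0, hD⟩ := exists_norm_fmult_oscSum_low_le hLP hψ hsupp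
    (σ := m + max s 0) (by positivity) hK
  refine ⟨(40 * K) ^ |s| * C + D, by positivity, ?_⟩
  intro J N c k lamb hc hcc hN hk hlamb A B hA0 hB0 hA hB R hR hRl x
  have hR0 : 0 < R := by linarith
  have hl0 : 0 < lamb := by linarith
  have hRs : 0 ≤ R ^ s := Real.rpow_nonneg hR0.le _
  have hls : 0 ≤ lamb ^ s := Real.rpow_nonneg hl0.le _
  have hlm : 0 ≤ lamb ^ (-(m:ℝ)) := Real.rpow_nonneg hl0.le _
  have hKs : 0 ≤ (40 * K) ^ |s| := by positivity
  rcases le_total (40 * K * R) lamb with h | h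
  · have hb := hD J N c k lamb hc hcc hN hk hl0 B hB0 hB R hR0 h x
    have hRlamb : R ≤ lamb := by nlinarith
    have hw : R ^ s * lamb ^ (-((m:ℝ) + max s 0)) ≤ lamb ^ (-(m:ℝ)) := by
      rw [neg_add, Real.rpow_add hl0, ← mul_assoc, mul_comm (R ^ s), mul_assoc]
      refine mul_le_of_le_one_right hlm ?_
      rw [Real.rpow_neg hl0.le, ← div_eq_mul_inv]
      refine div_le_one_of_le₀ ?_ (by positivity)
      exact (Real.rpow_le_rpow_of_exponent_le hR (le_max_left _ _)).trans
        (Real.rpow_le_rpow hR0.le hRlamb (le_max_right _ _))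
    calc R ^ s * ‖fmult (fun ξ => ψ (R⁻¹ • ξ)) (oscSum c k lamb) x‖
        ≤ R ^ s * (D * (N * (lamb ^ (-((m:ℝ) + max s 0)) * B))) := by gcongr
      _ = D * N * ((R ^ s * lamb ^ (-((m:ℝ) + max s 0))) * B) := by ring
      _ ≤ D * N * (lamb ^ (-(m:ℝ)) * B) := by gcongr
      _ ≤ ((40 * K) ^ |s| * C + D) * N * (lamb ^ s * A + lamb ^ (-(m:ℝ)) * B) := by
        gcongr
        · exact le_add_of_nonneg_left (by positivity)
        · exact le_add_of_nonneg_left (by positivity)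
  · have hf : Integrable (oscSum c k lamb) :=
      (contDiff_oscSum hc).continuous.integrable_of_hasCompactSupport (hasCompactSupport_oscSum hcc)
    have hb := hC _ hf _ (norm_oscSum_le (k := k) (lamb := lamb) hN hA0 fun j x =>
      (norm_le_C0Norm (hc j).continuous (hcc j) x).trans (hA j)) R hR0 x
    have hw : R ^ s ≤ (40 * K) ^ |s| * lamb ^ s :=
      rpow_le_of_comparable s hR0 hl0 (by linarith) (by nlinarith) (by linarith)
    calc R ^ s * ‖fmult (fun ξ => ψ (R⁻¹ • ξ)) (oscSum c k lamb) x‖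
        ≤ ((40 * K) ^ |s| * lamb ^ s) * (C * (N * A)) := by gcongr
      _ = (40 * K) ^ |s| * C * N * (lamb ^ s * A) := by ring
      _ ≤ ((40 * K) ^ |s| * C + D) * N * (lamb ^ s * A + lamb ^ (-(m:ℝ)) * B) := by
        gcongr
        · exact le_add_of_nonneg_right hD0
        · exact le_add_of_nonneg_right (by positivity)

/-- Weighted bound for the blocks whose scale exceeds the oscillation frequency. -/
lemma exists_rpow_mul_norm_fmult_oscSum_high_le {χ φ : V3 → ℝ} (hLP : LPpair χ φ)
    (s : ℝ) (m : ℕ) {K : ℝ} (hK : 1 ≤ K) :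
    ∃ C : ℝ, 0 ≤ C ∧ ∀ (J N : ℕ) (c : Fin J → V3 → ℂ) (k : Fin J → V3) (lamb : ℝ),
      (∀ j, ContDiff ℝ (⊤ : ℕ∞) (c j)) → (∀ j, HasCompactSupport (c j)) →
      (∀ x : V3, Set.ncard {j : Fin J | x ∈ tsupport (c j)} ≤ N) →
      (∀ j, norm3 (k j) ≤ K) → 1 ≤ lamb →
      ∀ A B : ℝ, 0 ≤ A → 0 ≤ B → (∀ j, C0Norm (c j) ≤ A) →
      (∀ j, CsNorm (m + max s 0) (c j) ≤ B) → ∀ R : ℝ, K * lamb ≤ R →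
      ∀ x, R ^ s * ‖fmult (fun ξ => φ (R⁻¹ • ξ)) (oscSum c k lamb) x‖
        ≤ C * N * (lamb ^ s * A + lamb ^ (-(m:ℝ)) * B) := by
  have hK0 : 0 < K := by linarith
  have hφc : HasCompactSupport φ :=
    hasCompactSupport_of_norm3 fun ξ h => hLP.suppAnn ξ fun h' => h h'.2
  obtain ⟨C, hC0, hC⟩ := exists_norm_fmult_dilate_le hLP.smooth' hφc
  obtain ⟨D, hD0, hD⟩ := exists_norm_fmult_oscSum_le hLP.smooth' hφc
    (σ := m + max s 0) (by positivity)
  refine ⟨C + D, by positivity, ?_⟩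
  intro J N c k lamb hc hcc hN hk hlamb A B hA0 hB0 hA hB R hRl x
  have hl0 : 0 < lamb := by linarith
  have hRlamb : lamb ≤ R := by nlinarith
  have hR0 : 0 < R := by linarith
  have hRs : 0 ≤ R ^ s := Real.rpow_nonneg hR0.le _
  have hls : 0 ≤ lamb ^ s := Real.rpow_nonneg hl0.le _
  have hlm : 0 ≤ lamb ^ (-(m:ℝ)) := Real.rpow_nonneg hl0.le _
  rcases le_total 0 s with hs | hs
  · have hb := hD J N c k lamb hc hcc hN B hB0 hB R hR0 (fun j => by
      have hfreq : norm3 ((lamb / (2 * Real.pi * R)) • k j) < 3 / 4 := by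
        have hpi := Real.pi_pos
        rw [norm3_smul, abs_of_nonneg (by positivity), div_mul_eq_mul_div,
          div_lt_iff₀ (by positivity)]
        have h1 : lamb * norm3 (k j) ≤ R := by nlinarith [hk j]
        nlinarith [Real.pi_gt_three]
      filter_upwards [continuous_norm3.continuousAt.eventually_lt_const hfreq] with ξ hξ
      exact hLP.suppAnn ξ fun h => lt_asymm h.1 hξ) x
    have hw : R ^ s * R ^ (-((m:ℝ) + max s 0)) ≤ lamb ^ (-(m:ℝ)) := by
      rw [max_eq_left hs, ← Real.rpow_add hR0]
      ring_nf
      exact Real.rpow_le_rpow_of_nonpos hl0 hRlamb (by simp)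
    calc R ^ s * ‖fmult (fun ξ => φ (R⁻¹ • ξ)) (oscSum c k lamb) x‖
        ≤ R ^ s * (D * (N * (R ^ (-((m:ℝ) + max s 0)) * B))) := by gcongr
      _ = D * N * ((R ^ s * R ^ (-((m:ℝ) + max s 0))) * B) := by ring
      _ ≤ D * N * (lamb ^ (-(m:ℝ)) * B) := by gcongr
      _ ≤ (C + D) * N * (lamb ^ s * A + lamb ^ (-(m:ℝ)) * B) := by
        gcongr
        · exact le_add_of_nonneg_left hC0
        · exact le_add_of_nonneg_left (by positivity)
  · have hf : Integrable (oscSum c k lamb) :=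
      (contDiff_oscSum hc).continuous.integrable_of_hasCompactSupport (hasCompactSupport_oscSum hcc)
    have hb := hC _ hf _ (norm_oscSum_le (k := k) (lamb := lamb) hN hA0 fun j x =>
      (norm_le_C0Norm (hc j).continuous (hcc j) x).trans (hA j)) R hR0 x
    have hw : R ^ s ≤ lamb ^ s := Real.rpow_le_rpow_of_nonpos hl0 hRlamb hs
    calc R ^ s * ‖fmult (fun ξ => φ (R⁻¹ • ξ)) (oscSum c k lamb) x‖
        ≤ lamb ^ s * (C * (N * A)) := by gcongr
      _ = C * N * (lamb ^ s * A) := by ring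
      _ ≤ (C + D) * N * (lamb ^ s * A + lamb ^ (-(m:ℝ)) * B) := by
        gcongr
        · exact le_add_of_nonneg_right hD0
        · exact le_add_of_nonneg_right (by positivity)

/-- **Lemma A.3 (stationary phase bounds in Besov spaces).** Let `s > -1`, `λ ≥ 1`, and let
`f = Σ_{j=1}^J c_j e^{iλ k_j·x}` with `C₀⁻¹ ≤ |k_j| ≤ C₀` and at most `J_*` of the supports of
the `c_j` overlapping at any point. Then for every `m ∈ ℕ`,
`‖f‖_{B^s_{∞,∞}} ≤ C_* (λ^s 𝒞₀ + λ^{-m} 𝒞_{m+s₊})`, where `𝒞_σ = max_j ‖c_j‖_σ` and `C_*`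
depends only on `s`, `m`, `J_*`, `C₀` (and the Littlewood–Paley pair), but not on `J`. -/
theorem stationary_phase_besov
    (χ φLP : V3 → ℝ) (hLP : LPpair χ φLP)
    (s : ℝ) (hs : -1 < s) (m : ℕ) (Jstar : ℕ) (C₀ : ℝ) (hC₀ : 0 < C₀) :
    ∃ Cstar : ℝ, 0 < Cstar ∧
      ∀ J : ℕ, ∀ c : Fin J → V3 → ℂ,
        (∀ j, ContDiff ℝ (⊤ : ℕ∞) (c j)) → (∀ j, HasCompactSupport (c j)) →
      ∀ k : Fin J → V3,
        (∀ j, C₀⁻¹ ≤ norm3 (k j) ∧ norm3 (k j) ≤ C₀) →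
      ∀ lamb : ℝ, 1 ≤ lamb →
        -- at most `J_*` of the supports have a common point
        (∀ x : V3, Set.ncard {j : Fin J | x ∈ tsupport (c j)} ≤ Jstar) →
        BesovNorm χ φLP s
            (fun x => ∑ j : Fin J, c j x * Complex.exp (Complex.I * lamb * (dot3 (k j) x : ℂ)))
          ≤ Cstar * (lamb ^ s * (⨆ j : Fin J, C0Norm (c j))
              + lamb ^ (-(m:ℝ)) * (⨆ j : Fin J, CsNorm ((m:ℝ) + max s 0) (c j))) := by
  obtain ⟨K, hK1, hK⟩ : ∃ K : ℝ, 1 ≤ K ∧ C₀ ≤ K := ⟨max C₀ 1, le_max_right _ _, le_max_left _ _⟩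
  obtain ⟨C₁, hC₁0, hC₁⟩ := exists_rpow_mul_norm_fmult_oscSum_le hLP hLP.smooth
    (fun ξ h => hLP.suppLow ξ fun h' => h (h'.trans (by norm_num))) s m hK1
  obtain ⟨C₂, hC₂0, hC₂⟩ := exists_rpow_mul_norm_fmult_oscSum_le hLP hLP.smooth'
    (fun ξ h => hLP.suppAnn ξ fun h' => h h'.2) s m hK1
  obtain ⟨C₃, hC₃0, hC₃⟩ := exists_rpow_mul_norm_fmult_oscSum_high_le hLP s m hK1
  refine ⟨(C₁ + (C₂ + C₃)) * Jstar + 1, by positivity, ?_⟩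
  intro J c hc hcc k hk lamb hlamb hN
  set A : ℝ := ⨆ j : Fin J, C0Norm (c j)
  set B : ℝ := ⨆ j : Fin J, CsNorm ((m:ℝ) + max s 0) (c j)
  have hA0 : 0 ≤ A := Real.iSup_nonneg fun j => C0Norm_nonneg _
  have hB0 : 0 ≤ B := Real.iSup_nonneg fun j => CsNorm_nonneg _ _
  have hA : ∀ j, C0Norm (c j) ≤ A := fun j =>
    le_ciSup (f := fun j => C0Norm (c j)) (Set.finite_range _).bddAbove j
  have hB : ∀ j, CsNorm ((m:ℝ) + max s 0) (c j) ≤ B := fun j =>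
    le_ciSup (f := fun j => CsNorm ((m:ℝ) + max s 0) (c j)) (Set.finite_range _).bddAbove j
  have hkl : ∀ j, K⁻¹ ≤ norm3 (k j) := fun j => (inv_anti₀ hC₀ hK).trans (hk j).1
  have hku : ∀ j, norm3 (k j) ≤ K := fun j => (hk j).2.trans hK
  have hl0 : 0 < lamb := by linarith
  set E : ℝ := lamb ^ s * A + lamb ^ (-(m:ℝ)) * B
  have hE0 : 0 ≤ E := by positivity
  change BesovNorm χ φLP s (oscSum c k lamb) ≤ _
  have hlow : C0Norm (lowProj χ (oscSum c k lamb)) ≤ C₁ * Jstar * E := by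
    refine C0Norm_le (by positivity) fun x => ?_
    have := hC₁ J Jstar c k lamb hc hcc hN hkl hlamb A B hA0 hB0 hA hB 1 le_rfl
      (by nlinarith) x
    simp only [inv_one, one_smul, Real.one_rpow, one_mul] at this
    exact this
  have hdyad : ∀ N : ℕ, (2:ℝ) ^ ((N:ℝ) * s) * C0Norm (dyadProj φLP N (oscSum c k lamb))
      ≤ (C₂ + C₃) * Jstar * E := by
    intro N
    have hR1 : (1:ℝ) ≤ 2 ^ N := one_le_pow₀ one_le_two
    have hw : (2:ℝ) ^ ((N:ℝ) * s) = ((2:ℝ) ^ N) ^ s := by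
      rw [Real.rpow_mul two_pos.le, Real.rpow_natCast]
    have hw0 : 0 < ((2:ℝ) ^ N) ^ s := by positivity
    rw [hw, mul_comm, ← le_div_iff₀ hw0]
    refine C0Norm_le (by positivity) fun x => ?_
    rw [le_div_iff₀ hw0, mul_comm]
    have hP : dyadProj φLP N (oscSum c k lamb)
        = fmult (fun ξ => φLP (((2:ℝ) ^ N)⁻¹ • ξ)) (oscSum c k lamb) := by
      simp only [dyadProj, zpow_neg, zpow_natCast]
    rw [hP]
    rcases le_total ((2:ℝ) ^ N) (K * lamb) with h | h
    · refine (hC₂ J Jstar c k lamb hc hcc hN hkl hlamb A B hA0 hB0 hA hB _ hR1 h x).trans ?_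
      gcongr
      exact le_add_of_nonneg_right hC₃0
    · refine (hC₃ J Jstar c k lamb hc hcc hN hku hlamb A B hA0 hB0 hA hB _ h x).trans ?_
      gcongr
      exact le_add_of_nonneg_left hC₂0
  calc BesovNorm χ φLP s (oscSum c k lamb)
      ≤ C₁ * Jstar * E + (C₂ + C₃) * Jstar * E := add_le_add hlow (ciSup_le hdyad)
    _ ≤ ((C₁ + (C₂ + C₃)) * Jstar + 1) * E := by linarith
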